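/- arXiv:2503.08898 — 2 statements merged into one kernel-verified Lean document; each statement's English description precedes it below -/
import Mathlib

section
/- Let r ≥ 2 be an integer and let A be an associative unital ℚ-algebra. Let R = A ⊗_ℚ ℚ[t₁,…,t_r, x₁, x₂, x₃, …] be the polynomial ring over A in the variables t₁,…,t_r and countably many variables x_k (k ≥ 1). For each permutation σ of {1,…,r}, let σ also denote the ring automorphism of R fixing A and every x_k and sending t_i ↦ t_{σ(i)}; for 1 ≤ i ≠ j ≤ r, let S_{i,j} denote the ring automorphism of R fixing A and every t_l and sending x_k ↦ x_k + (t_i^k − t_j^k)/k! for every k ≥ 1. Suppose f : R → ℚ is a ℚ-linear map such that f(S_{i,j}(p)) = f(p) for all i ≠ j and all p ∈ R, and f(σ(p)) = sgn(σ)·f(p) for every permutation σ of {1,…,r} and all p ∈ R. Then f = 0. -/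
open MvPolynomial

/-- The automorphism `S_{i,j}` of the polynomial ring `ℚ[t₁,…,t_r, x₁, x₂, …]`
(variables `t_i` indexed by `Fin r`, variables `x_k` indexed by `ℕ+`), fixing every `t_l`
and sending `x_k ↦ x_k + (t_i^k − t_j^k)/k!`. -/
noncomputable def heckeShift (r : ℕ) (i j : Fin r) :
    MvPolynomial (Fin r ⊕ ℕ+) ℚ →ₐ[ℚ] MvPolynomial (Fin r ⊕ ℕ+) ℚ :=
  MvPolynomial.aeval (Sum.elim
    (fun l : Fin r => MvPolynomial.X (Sum.inl l))
    (fun k : ℕ+ => MvPolynomial.X (Sum.inr k) +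
      MvPolynomial.C (((k : ℕ).factorial : ℚ)⁻¹) *
        (MvPolynomial.X (Sum.inl i) ^ (k : ℕ) - MvPolynomial.X (Sum.inl j) ^ (k : ℕ))))

/-- The automorphism of `ℚ[t₁,…,t_r, x₁, x₂, …]` fixing every `x_k` and
sending `t_i ↦ t_{σ(i)}`. -/
noncomputable def weylPerm (r : ℕ) (σ : Equiv.Perm (Fin r)) :
    MvPolynomial (Fin r ⊕ ℕ+) ℚ →ₐ[ℚ] MvPolynomial (Fin r ⊕ ℕ+) ℚ :=
  MvPolynomial.rename (Sum.map σ id)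

theorem core_pow {P : Type*} [CommRing P] [Algebra ℚ P] (S : P →ₐ[ℚ] P) (g : P →ₗ[ℚ] ℚ)
    (hg : ∀ p, g (S p) = g p) (u y : P) (hu : S u = u) (hy : S y = y + u) (n : ℕ) :
    ∀ b, S b = b → g (u * b * y ^ n) = 0 := by
  induction n using Nat.strong_induction_on with
  | _ n ih =>
    intro b hb
    have h := hg (b * y ^ (n + 1))
    rw [map_mul, map_pow, hb, hy, add_pow, Finset.sum_range_succ, Finset.sum_range_succ,
      mul_add, mul_add, map_add, map_add, Finset.mul_sum, map_sum, Finset.sum_eq_zero] at h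
    · have e1 : b * (y ^ n * u ^ (n + 1 - n) * ((n + 1).choose n : P))
          = ((n + 1 : ℕ) : ℚ) • (u * b * y ^ n) := by
        rw [Nat.choose_succ_self_right, Nat.add_sub_cancel_left, Algebra.smul_def, map_natCast]
        ring
      have e2 : b * (y ^ (n + 1) * u ^ (n + 1 - (n + 1)) * ((n + 1).choose (n + 1) : P))
          = b * y ^ (n + 1) := by simp
      rw [e1, e2, map_smul, smul_eq_mul] at h
      have h3 : ((n + 1 : ℕ) : ℚ) * g (u * b * y ^ n) = 0 := by linarith
      rcases mul_eq_zero.1 h3 with h4 | h4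
      · exact absurd h4 (by positivity)
      · exact h4
    · intro m hm
      have hm := Finset.mem_range.1 hm
      have e : b * (y ^ m * u ^ (n + 1 - m) * ((n + 1).choose m : P))
          = u * (b * u ^ (n - m) * ((n + 1).choose m : P)) * y ^ m := by
        rw [show n + 1 - m = (n - m) + 1 by omega]
        ring
      rw [e]
      exact ih m hm _ (by simp [hb, hu])

theorem core_all (r : ℕ) (i j : Fin r) (g : MvPolynomial (Fin r ⊕ ℕ+) ℚ →ₗ[ℚ] ℚ)
    (hg : ∀ p, g (heckeShift r i j p) = g p) (p : MvPolynomial (Fin r ⊕ ℕ+) ℚ) :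
    ∀ b, heckeShift r i j b = b → ∀ n : ℕ,
      g ((X (Sum.inl i) - X (Sum.inl j)) * b * X (Sum.inr 1) ^ n * p) = 0 := by
  have hT : ∀ l, heckeShift r i j (X (Sum.inl l)) = X (Sum.inl l) := by
    intro l; simp [heckeShift]
  have hX : ∀ k : ℕ+, heckeShift r i j (X (Sum.inr k)) = X (Sum.inr k) +
      C (((k : ℕ).factorial : ℚ)⁻¹) *
        (X (Sum.inl i) ^ (k : ℕ) - X (Sum.inl j) ^ (k : ℕ)) := by
    intro k; simp [heckeShift]
  have hC : ∀ c : ℚ, heckeShift r i j (C c) = C c := by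
    intro c; simp [heckeShift]
  have hX1 : heckeShift r i j (X (Sum.inr 1)) = X (Sum.inr 1) +
      (X (Sum.inl i) - X (Sum.inl j)) := by
    rw [hX]; simp
  induction p using MvPolynomial.induction_on with
  | C c =>
    intro b hb n
    have := core_pow (heckeShift r i j) g hg (X (Sum.inl i) - X (Sum.inl j)) (X (Sum.inr 1))
      (by rw [map_sub, hT, hT]) hX1 n (b * C c) (by rw [map_mul, hb, hC])
    exact (congrArg g (by ring)).trans this
  | add p q hp hq =>
    intro b hb n
    rw [mul_add, map_add, hp b hb, hq b hb, add_zero]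
  | mul_X p v hp =>
    intro b hb n
    rcases v with l | k
    · have := hp (b * X (Sum.inl l)) (by rw [map_mul, hb, hT]) n
      exact (congrArg g (by ring)).trans this
    · obtain ⟨h, hh, hS⟩ : ∃ h : MvPolynomial (Fin r ⊕ ℕ+) ℚ,
          C (((k : ℕ).factorial : ℚ)⁻¹) * (X (Sum.inl i) ^ (k : ℕ) - X (Sum.inl j) ^ (k : ℕ))
            = h * (X (Sum.inl i) - X (Sum.inl j)) ∧ heckeShift r i j h = h := by
        refine ⟨C (((k : ℕ).factorial : ℚ)⁻¹) * ∑ m ∈ Finset.range k,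
          X (Sum.inl i) ^ m * X (Sum.inl j) ^ ((k : ℕ) - 1 - m), ?_, ?_⟩
        · rw [mul_assoc, (Commute.all _ _).geom_sum₂_mul]
        · simp only [map_mul, map_sum, map_pow, hT, hC]
      have h1 := hp (b * (X (Sum.inr k) - h * X (Sum.inr 1)))
        (by rw [map_mul, hb, map_sub, map_mul, hS, hX, hX1, hh]; ring) n
      have h2 := hp (b * h) (by rw [map_mul, hb, hS]) (n + 1)
      have h3 := congrArg₂ (· + ·) h1 h2
      simp only [← map_add, add_zero] at h3
      exact (congrArg g (by ring)).trans h3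

theorem swap_sub (r : ℕ) (i j : Fin r) (p : MvPolynomial (Fin r ⊕ ℕ+) ℚ) :
    ∃ q, weylPerm r (Equiv.swap i j) p = p + (X (Sum.inl i) - X (Sum.inl j)) * q := by
  induction p using MvPolynomial.induction_on with
  | C c => exact ⟨0, by simp [weylPerm]⟩
  | add p q hp hq =>
    obtain ⟨a, ha⟩ := hp
    obtain ⟨b, hb⟩ := hq
    exact ⟨a + b, by rw [map_add, ha, hb]; ring⟩
  | mul_X p v hp =>
    obtain ⟨a, ha⟩ := hp
    obtain ⟨c, hc⟩ : ∃ c, weylPerm r (Equiv.swap i j) (X v)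
        = X v + (X (Sum.inl i) - X (Sum.inl j)) * c := by
      rcases v with l | k
      · by_cases hi : l = i
        · subst hi
          exact ⟨-1, by simp [weylPerm]⟩
        · by_cases hj : l = j
          · subst hj
            exact ⟨1, by simp [weylPerm]⟩
          · exact ⟨0, by simp [weylPerm, Equiv.swap_apply_of_ne_of_ne hi hj]⟩
      · exact ⟨0, by simp [weylPerm]⟩
    exact ⟨p * c + a * X v + a * (X (Sum.inl i) - X (Sum.inl j)) * c, by
      rw [map_mul, ha, hc]; ring⟩

/-- **Proposition 7.5 (algebraic core).** Let `r ≥ 2`, `A` an associative unital `ℚ`-algebra,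
and `R = A ⊗_ℚ ℚ[t₁,…,t_r, x₁, x₂, …]`. If a `ℚ`-linear functional `f : R → ℚ` is invariant
under all `S_{i,j}` (`i ≠ j`) and anti-invariant under the `Σ_r`-action permuting the `t_i`
(all automorphisms acting as the identity on the factor `A`), then `f = 0`. -/
theorem stmt5 (r : ℕ) (hr : 2 ≤ r) (A : Type*) [Ring A] [Algebra ℚ A]
    (f : TensorProduct ℚ A (MvPolynomial (Fin r ⊕ ℕ+) ℚ) →ₗ[ℚ] ℚ)
    (hS : ∀ i j : Fin r, i ≠ j → ∀ p,
      f (Algebra.TensorProduct.map (AlgHom.id ℚ A) (heckeShift r i j) p) = f p)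
    (hW : ∀ σ : Equiv.Perm (Fin r), ∀ p,
      f (Algebra.TensorProduct.map (AlgHom.id ℚ A) (weylPerm r σ) p)
        = ((Equiv.Perm.sign σ : ℤ) : ℚ) * f p) :
    f = 0 := by
  refine TensorProduct.ext' fun a p => ?_
  let i : Fin r := ⟨0, by omega⟩
  let j : Fin r := ⟨1, by omega⟩
  have hij : i ≠ j := by simp [i, j]
  let g : MvPolynomial (Fin r ⊕ ℕ+) ℚ →ₗ[ℚ] ℚ := f ∘ₗ TensorProduct.mk ℚ A _ a
  have hg : ∀ p, g (heckeShift r i j p) = g p := fun p => hS i j hij (TensorProduct.tmul ℚ a p)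
  have hw : g (weylPerm r (Equiv.swap i j) p) = - g p := by
    have := hW (Equiv.swap i j) (TensorProduct.tmul ℚ a p)
    rw [Equiv.Perm.sign_swap hij] at this
    simpa [g] using this
  obtain ⟨q, hq⟩ := swap_sub r i j p
  have h0 := core_all r i j g hg q 1 (map_one _) 0
  rw [mul_one, pow_zero, mul_one] at h0
  rw [hq, map_add, h0] at hw
  change g p = 0
  linarith
end

section
/- Let r ≥ 2 be an integer, let S be an index set and w : S → ℕ a weight function. Let R = ℚ[t₁,…,t_r, x₁, x₂, …, (y_s)_{s∈S}] be the polynomial ring over ℚ in the variables t_i (1 ≤ i ≤ r), x_k (k ≥ 1) and y_s (s ∈ S). Assign the weight 1 to each t_i, the weight k+1 to x_k, and the weight w(s) to y_s, and for n ∈ ℕ let C_n ⊆ R be the ℚ-span of all monomials of total weight ≤ n. For each permutation σ of {1,…,r}, let σ also denote the ring automorphism of R fixing every x_k and y_s and sending t_i ↦ t_{σ(i)}; for 1 ≤ i ≠ j ≤ r, let S_{i,j} denote the ring automorphism of R fixing every t_l and y_s and sending x_k ↦ x_k + (t_i^k − t_j^k)/k!. Fix n ∈ ℕ and suppose f : R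 → ℚ is a ℚ-linear map such that f(S_{i,j}(p)) = f(p) and f(σ(p)) = sgn(σ)·f(p) for all i ≠ j, all permutations σ, and all p ∈ C_{n+1}. Then f vanishes on C_n. -/
open MvPolynomial

/-- The weight function on the variables of `ℚ[t₁,…,t_r, x₁, x₂, …, (y_s)_{s∈S}]`:
`t_i` has weight `1`, `x_k` has weight `k+1`, `y_s` has weight `w(s)`. -/
def chernWeight (r : ℕ) {S : Type*} (w : S → ℕ) : (Fin r ⊕ ℕ+ ⊕ S) → ℕ :=
  Sum.elim (fun _ : Fin r => 1) (Sum.elim (fun k : ℕ+ => (k : ℕ) + 1) w)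

/-- The automorphism `S_{i,j}` of `ℚ[t₁,…,t_r, x₁, x₂, …, (y_s)_{s∈S}]`, fixing every `t_l`
and every `y_s`, and sending `x_k ↦ x_k + (t_i^k − t_j^k)/k!`. -/
noncomputable def heckeShiftY (r : ℕ) (S : Type*) (i j : Fin r) :
    MvPolynomial (Fin r ⊕ ℕ+ ⊕ S) ℚ →ₐ[ℚ] MvPolynomial (Fin r ⊕ ℕ+ ⊕ S) ℚ :=
  MvPolynomial.aeval (Sum.elim
    (fun l : Fin r => MvPolynomial.X (Sum.inl l))
    (Sum.elim
      (fun k : ℕ+ => MvPolynomial.X (Sum.inr (Sum.inl k)) +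
        MvPolynomial.C (((k : ℕ).factorial : ℚ)⁻¹) *
          (MvPolynomial.X (Sum.inl i) ^ (k : ℕ) - MvPolynomial.X (Sum.inl j) ^ (k : ℕ)))
      (fun s : S => MvPolynomial.X (Sum.inr (Sum.inr s)))))

/-- All monomials of `p` have weight at most `d` (an integer, possibly negative). -/
def WtLE {σ : Type*} (v : σ → ℕ) (d : ℤ) (p : MvPolynomial σ ℚ) : Prop :=
  ∀ m ∈ p.support, ((Finsupp.weight v m : ℕ) : ℤ) ≤ d

section WtLEsec
variable {σ : Type*} {v : σ → ℕ}

lemma wtLE_iff (n : ℕ) (p : MvPolynomial σ ℚ) :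
    WtLE v n p ↔ weightedTotalDegree v p ≤ n := by
  unfold WtLE weightedTotalDegree
  rw [Finset.sup_le_iff]
  simp only [Nat.cast_le]

lemma WtLE.mono {d d' : ℤ} {p : MvPolynomial σ ℚ} (h : WtLE v d p) (hd : d ≤ d') :
    WtLE v d' p := fun m hm => (h m hm).trans hd

lemma WtLE.zero (d : ℤ) : WtLE v d (0 : MvPolynomial σ ℚ) := by
  intro m hm; simp at hm

lemma WtLE.eq_zero {d : ℤ} {p : MvPolynomial σ ℚ} (h : WtLE v d p) (hd : d < 0) : p = 0 := by
  rw [← MvPolynomial.support_eq_empty, Finset.eq_empty_iff_forall_notMem]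
  intro m hm
  have := h m hm
  omega

lemma WtLE.add {d : ℤ} {p q : MvPolynomial σ ℚ} (hp : WtLE v d p) (hq : WtLE v d q) :
    WtLE v d (p + q) := by
  classical
  intro m hm
  rcases Finset.mem_union.1 (MvPolynomial.support_add hm) with h | h
  · exact hp m h
  · exact hq m h

lemma WtLE.neg {d : ℤ} {p : MvPolynomial σ ℚ} (hp : WtLE v d p) : WtLE v d (-p) := by
  intro m hm
  rw [MvPolynomial.support_neg] at hm
  exact hp m hm

lemma WtLE.sub {d : ℤ} {p q : MvPolynomial σ ℚ} (hp : WtLE v d p) (hq : WtLE v d q) :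
    WtLE v d (p - q) := by
  rw [sub_eq_add_neg]; exact hp.add hq.neg

lemma WtLE.mul {d e : ℤ} {p q : MvPolynomial σ ℚ} (hp : WtLE v d p) (hq : WtLE v e q) :
    WtLE v (d + e) (p * q) := by
  classical
  intro m hm
  obtain ⟨a, ha, b, hb, rfl⟩ := Finset.mem_add.1 (MvPolynomial.support_mul p q hm)
  have h1 := hp a ha
  have h2 := hq b hb
  rw [map_add]; push_cast; omega

lemma WtLE.C (a : ℚ) : WtLE v 0 (MvPolynomial.C a : MvPolynomial σ ℚ) := by
  classical
  intro m hm
  have := MvPolynomial.support_monomial_subset hm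
  rw [Finset.mem_singleton] at this
  subst this; simp

lemma WtLE.X (i : σ) : WtLE v (v i) (MvPolynomial.X i : MvPolynomial σ ℚ) := by
  intro m hm
  rw [MvPolynomial.support_X, Finset.mem_singleton] at hm
  subst hm
  simp [Finsupp.weight_single]

lemma WtLE.natCast (a : ℕ) : WtLE v 0 (a : MvPolynomial σ ℚ) := by
  have := WtLE.C (v := v) (a : ℚ)
  simpa using this

lemma WtLE.pow {d : ℤ} {p : MvPolynomial σ ℚ} (hp : WtLE v d p) (k : ℕ) :
    WtLE v (k * d) (p ^ k) := by
  induction k with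
  | zero => simpa using WtLE.C (v := v) 1
  | succ k ih =>
    rw [pow_succ]
    exact (ih.mul hp).mono (by push_cast; linarith)

lemma WtLE.sum {ι : Type*} {d : ℤ} (s : Finset ι) (g : ι → MvPolynomial σ ℚ)
    (h : ∀ i ∈ s, WtLE v d (g i)) : WtLE v d (∑ i ∈ s, g i) := by
  classical
  induction s using Finset.induction_on with
  | empty => simpa using WtLE.zero d
  | insert a s ha ih =>
    rw [Finset.sum_insert ha]
    exact (h a (by simp)).add (ih fun i hi => h i (by simp [hi]))

/-- Divided difference control for an algebra endomorphism. -/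
lemma divided_diff (φ : MvPolynomial σ ℚ →ₐ[ℚ] MvPolynomial σ ℚ) (u : MvPolynomial σ ℚ) (c : ℤ)
    (h1 : ∀ i, WtLE v (v i) (φ (MvPolynomial.X i)))
    (h2 : ∀ i, ∃ e, φ (MvPolynomial.X i) = MvPolynomial.X i + u * e ∧ WtLE v (v i - c) e)
    (d : ℤ) (q : MvPolynomial σ ℚ) (hq : WtLE v d q) :
    WtLE v d (φ q) ∧ ∃ e, φ q = q + u * e ∧ WtLE v (d - c) e := by
  classical
  have key : ∀ (s : σ →₀ ℕ) (a : ℚ), ∀ d : ℤ, WtLE v d (MvPolynomial.monomial s a) →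
      WtLE v d (φ (MvPolynomial.monomial s a)) ∧
      ∃ e, φ (MvPolynomial.monomial s a) = MvPolynomial.monomial s a + u * e ∧
        WtLE v (d - c) e := by
    intro s a
    refine MvPolynomial.induction_on_monomial
      (motive := fun p => ∀ d : ℤ, WtLE v d p →
        WtLE v d (φ p) ∧ ∃ e, φ p = p + u * e ∧ WtLE v (d - c) e) ?_ ?_ s a
    · intro a d hd
      have : φ (MvPolynomial.C a) = MvPolynomial.C a := φ.commutes a
      rw [this]
      exact ⟨hd, 0, by simp, WtLE.zero _⟩
    · intro p i ih d hd
      have hp : WtLE v (d - v i) p := by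
        intro m hm
        have := hd (m + Finsupp.single i 1) (by
          rw [MvPolynomial.mem_support_iff, MvPolynomial.coeff_mul_X]
          exact MvPolynomial.mem_support_iff.1 hm)
        rw [map_add, Finsupp.weight_single] at this
        push_cast at this
        simp at this
        omega
      obtain ⟨g1, e, he, hwe⟩ := ih _ hp
      obtain ⟨e', he', hwe'⟩ := h2 i
      rw [map_mul]
      refine ⟨(g1.mul (h1 i)).mono (by omega), e * φ (MvPolynomial.X i) + p * e', ?_, ?_⟩
      · rw [he, he']; ring
      · exact ((hwe.mul (h1 i)).mono (by omega)).add ((hp.mul hwe').mono (by omega))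
  have hk : ∀ m ∈ q.support, WtLE v d (MvPolynomial.monomial m (q.coeff m)) := by
    intro m hm m' hm'
    have := MvPolynomial.support_monomial_subset hm'
    rw [Finset.mem_singleton] at this
    subst this
    exact hq _ hm
  have hq' : φ q = ∑ m ∈ q.support, φ (MvPolynomial.monomial m (q.coeff m)) := by
    rw [← map_sum, ← MvPolynomial.as_sum]
  have hex : ∀ m, ∃ e, m ∈ q.support → (φ (MvPolynomial.monomial m (q.coeff m)) =
      MvPolynomial.monomial m (q.coeff m) + u * e ∧ WtLE v (d - c) e) := by
    intro m
    by_cases hm : m ∈ q.support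
    · obtain ⟨e, he⟩ := (key m _ d (hk m hm)).2
      exact ⟨e, fun _ => he⟩
    · exact ⟨0, fun h => absurd h hm⟩
  choose e he using hex
  refine ⟨?_, ∑ m ∈ q.support, e m, ?_, ?_⟩
  · rw [hq']
    exact WtLE.sum _ _ fun m hm => (key m _ d (hk m hm)).1
  · rw [hq', Finset.sum_congr rfl fun m hm => (he m hm).1, Finset.sum_add_distrib,
      ← MvPolynomial.as_sum, Finset.mul_sum]
  · exact WtLE.sum _ _ fun m hm => (he m hm).2

lemma binom_expand (x u : MvPolynomial σ ℚ) (hx : WtLE v 2 x) (hu : WtLE v 1 u) (m : ℕ) :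
    ∃ R, (x + u) ^ (m + 1) = x ^ (m + 1) + (m + 1 : MvPolynomial σ ℚ) * x ^ m * u + u ^ 2 * R ∧
      WtLE v (2 * m - 2) R := by
  induction m with
  | zero => exact ⟨0, by simp, WtLE.zero _⟩
  | succ m ih =>
    obtain ⟨R, hR, hw⟩ := ih
    refine ⟨((m + 1 : ℕ) : MvPolynomial σ ℚ) * x ^ m + R * x + R * u, ?_, ?_⟩
    · rw [pow_succ, hR]; push_cast; ring
    · refine WtLE.add (WtLE.add ?_ ?_) ?_
      · exact ((WtLE.natCast _).mul (hx.pow m)).mono (by push_cast; linarith)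
      · exact (hw.mul hx).mono (by push_cast; linarith)
      · exact (hw.mul hu).mono (by push_cast; linarith)

lemma vanish_core (φ : MvPolynomial σ ℚ →ₐ[ℚ] MvPolynomial σ ℚ) (x u : MvPolynomial σ ℚ)
    (hx : WtLE v 2 x) (hu : WtLE v 1 u) (hφx : φ x = x + u)
    (hφ : ∀ (d : ℤ) q, WtLE v d q → ∃ e, φ q = q + u * e ∧ WtLE v (d - 2) e)
    (n : ℕ) (f : MvPolynomial σ ℚ →ₗ[ℚ] ℚ)
    (hf : ∀ p, WtLE v (n + 1) p → f (φ p) = f p) :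
    ∀ (N : ℕ) (d : ℤ) q, d < N → d ≤ n - 1 → WtLE v d q → f (u * q) = 0 := by
  intro N
  induction N with
  | zero =>
    intro d q hd _ hq
    rw [hq.eq_zero (by simpa using hd)]; simp
  | succ N ihN =>
    intro d q hd hdn hq
    push_cast at hd
    have inner : ∀ (K : ℕ) (e : ℤ) (m : ℕ) q, e < K → e + 2 * m ≤ d → WtLE v e q →
        f (u * (x ^ m * q)) = 0 := by
      intro K
      induction K with
      | zero =>
        intro e m q he _ hq
        rw [hq.eq_zero (by simpa using he)]; simp
      | succ K ihK =>
        intro e m q he hem hq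
        push_cast at he
        obtain ⟨e', he', hwe'⟩ := hφ e q hq
        obtain ⟨R, hR, hwR⟩ := binom_expand x u hx hu m
        have hp : WtLE v (n + 1) (x ^ (m + 1) * q) :=
          ((hx.pow (m + 1)).mul hq).mono (by push_cast; linarith)
        have h0 := hf _ hp
        have a1 : f (u * (u * R * q)) = 0 :=
          ihN (d - 1) _ (by omega) (by omega) (((hu.mul hwR).mul hq).mono (by linarith))
        have a2 : f (u * (x ^ (m + 1) * e')) = 0 :=
          ihK (e - 2) (m + 1) e' (by omega) (by push_cast; omega) hwe'
        have hwR' : WtLE v (2 * m) (((m + 1 : ℕ) : MvPolynomial σ ℚ) * x ^ m + u * R) :=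
          (((WtLE.natCast _).mul (hx.pow m)).mono (by linarith)).add
            ((hu.mul hwR).mono (by linarith))
        have a3 : f (u * (u * (((m + 1 : ℕ) : MvPolynomial σ ℚ) * x ^ m + u * R) * e')) = 0 :=
          ihN (d - 1) _ (by omega) (by omega) (((hu.mul hwR').mul hwe').mono (by linarith))
        have hexp : φ (x ^ (m + 1) * q) = x ^ (m + 1) * q + ((m + 1 : ℕ) : ℚ) • (u * (x ^ m * q))
            + u * (u * R * q) + u * (x ^ (m + 1) * e')
            + u * (u * (((m + 1 : ℕ) : MvPolynomial σ ℚ) * x ^ m + u * R) * e') := by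
          rw [map_mul, map_pow, hφx, hR, he', MvPolynomial.smul_eq_C_mul, map_natCast]
          push_cast
          ring
        rw [hexp] at h0
        simp only [map_add, map_smul, a1, a2, a3, smul_eq_mul] at h0
        have h1 : ((m + 1 : ℕ) : ℚ) * f (u * (x ^ m * q)) = 0 := by linarith
        rcases mul_eq_zero.1 h1 with h | h
        · exfalso
          exact Nat.succ_ne_zero m (by exact_mod_cast h)
        · exact h
    have := inner (d.toNat + 1) d 0 q (by push_cast; omega) (by simp) hq
    simpa using this

end WtLEsec

/-- **Corollary 7.7 (algebraic core).** Let `r ≥ 2` and consider the weighted polynomial ring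
`R = ℚ[t₁,…,t_r, x₁, x₂, …, (y_s)_{s∈S}]` with weights `1`, `k+1`, `w(s)`, and `C_n ⊆ R` the
span of monomials of weight `≤ n` (i.e. polynomials of weighted total degree `≤ n`). If a
`ℚ`-linear functional `f : R → ℚ` is `S_{i,j}`-invariant and `Σ_r`-anti-invariant on `C_{n+1}`,
then `f` vanishes on `C_n`. -/
theorem stmt6 (r : ℕ) (hr : 2 ≤ r) (S : Type*) (w : S → ℕ) (n : ℕ)
    (f : MvPolynomial (Fin r ⊕ ℕ+ ⊕ S) ℚ →ₗ[ℚ] ℚ)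
    (hS : ∀ i j : Fin r, i ≠ j → ∀ p : MvPolynomial (Fin r ⊕ ℕ+ ⊕ S) ℚ,
      MvPolynomial.weightedTotalDegree (chernWeight r w) p ≤ n + 1 →
      f (heckeShiftY r S i j p) = f p)
    (hW : ∀ σ : Equiv.Perm (Fin r), ∀ p : MvPolynomial (Fin r ⊕ ℕ+ ⊕ S) ℚ,
      MvPolynomial.weightedTotalDegree (chernWeight r w) p ≤ n + 1 →
      f (MvPolynomial.rename (Sum.map σ id) p) = ((Equiv.Perm.sign σ : ℤ) : ℚ) * f p) :
    ∀ p : MvPolynomial (Fin r ⊕ ℕ+ ⊕ S) ℚ,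
      MvPolynomial.weightedTotalDegree (chernWeight r w) p ≤ n → f p = 0 := by
  have h01 : (⟨0, by omega⟩ : Fin r) ≠ ⟨1, by omega⟩ := by simp
  generalize (⟨0, by omega⟩ : Fin r) = i at h01
  generalize (⟨1, by omega⟩ : Fin r) = j at h01
  intro p hp
  have hXt : ∀ l : Fin r, WtLE (chernWeight r w) 1
      (X (Sum.inl l) : MvPolynomial (Fin r ⊕ ℕ+ ⊕ S) ℚ) := fun l => by
    simpa [chernWeight] using WtLE.X (v := chernWeight r w) (Sum.inl l)
  have hu : WtLE (chernWeight r w) 1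
      (X (Sum.inl i) - X (Sum.inl j) : MvPolynomial (Fin r ⊕ ℕ+ ⊕ S) ℚ) := (hXt i).sub (hXt j)
  have hx : WtLE (chernWeight r w) 2
      (X (Sum.inr (Sum.inl 1)) : MvPolynomial (Fin r ⊕ ℕ+ ⊕ S) ℚ) := by
    simpa [chernWeight] using WtLE.X (v := chernWeight r w) (Sum.inr (Sum.inl (1 : ℕ+)))
  have h2 : ∀ a, ∃ e, heckeShiftY r S i j (X a) = X a + (X (Sum.inl i) - X (Sum.inl j)) * e ∧
      WtLE (chernWeight r w) (chernWeight r w a - 2) e := by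
    rintro (l | k | s)
    · exact ⟨0, by simp [heckeShiftY], WtLE.zero _⟩
    · refine ⟨C (((k : ℕ).factorial : ℚ)⁻¹) * ∑ a ∈ Finset.range (k : ℕ),
        X (Sum.inl i) ^ a * X (Sum.inl j) ^ ((k : ℕ) - 1 - a), ?_, ?_⟩
      · simp only [heckeShiftY, aeval_X, Sum.elim_inr, Sum.elim_inl]
        rw [← geom_sum₂_mul]
        ring
      · refine ((WtLE.C _).mul (WtLE.sum (d := (k : ℕ) - 1) _ _ fun a ha => ?_)).mono ?_
        · rw [Finset.mem_range] at ha
          exact (((hXt i).pow a).mul ((hXt j).pow _)).mono (by omega)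
        · simp [chernWeight]; omega
    · exact ⟨0, by simp [heckeShiftY], WtLE.zero _⟩
  have h1 : ∀ a, WtLE (chernWeight r w) (chernWeight r w a) (heckeShiftY r S i j (X a)) := by
    intro a
    obtain ⟨e, he, hwe⟩ := h2 a
    rw [he]
    exact (WtLE.X a).add ((hu.mul hwe).mono (by omega))
  have hv := vanish_core (v := chernWeight r w) (heckeShiftY r S i j) (X (Sum.inr (Sum.inl 1)))
    (X (Sum.inl i) - X (Sum.inl j)) hx hu (by simp [heckeShiftY])
    (fun d q hq => (divided_diff _ _ 2 h1 h2 d q hq).2) n f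
    (fun p hp => hS i j h01 p ((wtLE_iff _ _).1 (by exact_mod_cast hp)))
  have t1 : ∀ a, WtLE (chernWeight r w) (chernWeight r w a)
      (rename (Sum.map (Equiv.swap i j) id) (X a : MvPolynomial (Fin r ⊕ ℕ+ ⊕ S) ℚ)) := by
    rintro (l | k | s)
    · rw [rename_X]; exact WtLE.X (v := chernWeight r w) (Sum.inl (Equiv.swap i j l))
    · rw [rename_X]; exact WtLE.X (v := chernWeight r w) (Sum.inr (Sum.inl k))
    · rw [rename_X]; exact WtLE.X (v := chernWeight r w) (Sum.inr (Sum.inr s))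
  have t2 : ∀ a, ∃ e, rename (Sum.map (Equiv.swap i j) id)
      (X a : MvPolynomial (Fin r ⊕ ℕ+ ⊕ S) ℚ) = X a + (X (Sum.inl i) - X (Sum.inl j)) * e ∧
      WtLE (chernWeight r w) (chernWeight r w a - 1) e := by
    have hone : WtLE (chernWeight r w) 0 (1 : MvPolynomial (Fin r ⊕ ℕ+ ⊕ S) ℚ) := by
      simpa using WtLE.C (v := chernWeight r w) 1
    rintro (l | k | s)
    · by_cases hi : l = i
      · subst hi
        exact ⟨-1, by simp, by simpa [chernWeight] using hone.neg⟩
      · by_cases hj : l = j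
        · subst hj
          exact ⟨1, by simp, by simpa [chernWeight] using hone⟩
        · exact ⟨0, by simp [Equiv.swap_apply_of_ne_of_ne hi hj], WtLE.zero _⟩
    · exact ⟨0, by simp, WtLE.zero _⟩
    · exact ⟨0, by simp, WtLE.zero _⟩
  obtain ⟨e, he, hwe⟩ := (divided_diff _ _ 1 t1 t2 n p ((wtLE_iff _ _).2 hp)).2
  have hz := hv n (n - 1) e (by omega) le_rfl hwe
  have hs := hW (Equiv.swap i j) p (by omega)
  rw [he, map_add, hz, Equiv.Perm.sign_swap h01] at hs
  push_cast at hs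
  linarith
end
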